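/- arXiv:0908.3784 — 6 statements merged into one kernel-verified Lean document; each statement's English description precedes it below -/
import Mathlib

section
/- Let F : Σ* → ℝ be an average preserving word function such that for every w ∈ Σ^ω, lim_{k→∞} F(pref_k(w)) = 0. Then F is identically zero. -/
open Filter Topology

/-- The prefix of length `k` of an infinite word `w`. -/
def pref {A : Type*} (w : ℕ → A) (k : ℕ) : List A := (List.range k).map w

/-- A word function `F : Σ* → ℝ` is average preserving: `∑_{a∈Σ} F(va) = |Σ| ⬝ F(v)`. -/
def AveragePreserving {A : Type*} [Fintype A] (F : List A → ℝ) : Prop :=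
  ∀ v : List A, ∑ a : A, F (v ++ [a]) = (Fintype.card A : ℝ) * F v

/-- Under an average preserving function, every word extends to an infinite word along whose
further prefixes the function stays at least as large. -/
theorem AveragePreserving.exists_le_pref {A : Type*} [Fintype A] [Nonempty A]
    {F : List A → ℝ} (hap : AveragePreserving F) (v : List A) :
    ∃ w : ℕ → A, ∀ k, F v ≤ F (pref w (v.length + k)) := by
  have step : ∀ u : List A, ∃ a : A, F u ≤ F (u ++ [a]) := by
    intro u
    obtain ⟨a, -, ha⟩ := Finset.exists_le_of_sum_le (s := (Finset.univ : Finset A))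
      (f := fun _ => F u) (g := fun a => F (u ++ [a])) Finset.univ_nonempty
      (by simp [hap u])
    exact ⟨a, ha⟩
  choose f hf using step
  let u : ℕ → List A := fun n => Nat.rec v (fun _ l => l ++ [f l]) n
  let w : ℕ → A := fun i => if h : i < v.length then v[i] else f (u (i - v.length))
  have hpref : ∀ k, pref w (v.length + k) = u k := by
    intro k
    induction k with
    | zero =>
      change (List.range v.length).map w = v
      refine List.ext_getElem (by simp) fun i _ hi => ?_
      simp [w, hi]
    | succ k ih =>
      have hw : w (v.length + k) = f (u k) := by simp [w]
      change (List.range (v.length + k + 1)).map w = u k ++ [f (u k)]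
      rw [List.range_succ, List.map_append, List.map_singleton, hw, ← ih, pref]
  refine ⟨w, fun k => ?_⟩
  rw [hpref]
  induction k with
  | zero => exact le_rfl
  | succ k ih => exact ih.trans (hf (u k))

/-- An average preserving function tending to zero along every infinite word is nonpositive. -/
theorem AveragePreserving.nonpos_of_tendsto_zero {A : Type*} [Fintype A] [Nonempty A]
    {F : List A → ℝ} (hap : AveragePreserving F)
    (h0 : ∀ w : ℕ → A, Tendsto (fun k => F (pref w k)) atTop (𝓝 0)) (v : List A) :
    F v ≤ 0 := by
  obtain ⟨w, hw⟩ := hap.exists_le_pref v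
  refine ge_of_tendsto (h0 w) ?_
  filter_upwards [eventually_ge_atTop v.length] with k hk
  simpa [Nat.add_sub_cancel' hk] using hw (k - v.length)

/-- An average preserving word function whose ω-function is identically zero
is itself identically zero. -/
theorem ap_zero_omega_implies_zero
    {A : Type*} [Fintype A] [Nonempty A]
    (F : List A → ℝ) (hap : AveragePreserving F)
    (h0 : ∀ w : ℕ → A, Tendsto (fun k => F (pref w k)) atTop (𝓝 0)) :
    ∀ v : List A, F v = 0 := by
  intro v
  refine le_antisymm (hap.nonpos_of_tendsto_zero h0 v) ?_
  have hneg : AveragePreserving fun u => -F u := fun u => by simp [hap u]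
  simpa using hneg.nonpos_of_tendsto_zero (fun w => by simpa using (h0 w).neg) v
end

section
/- Let F, G : Σ* → ℝ be two average preserving word functions such that f(w) := lim_{k→∞} F(pref_k(w)) and lim_{k→∞} G(pref_k(w)) exist and are equal for every w ∈ Σ^ω. Then F = G. -/
open Filter Topology

theorem pref_succ {A : Type*} (w : ℕ → A) (k : ℕ) : pref w (k + 1) = pref w k ++ [w k] := by
  simp [pref, List.range_succ]

/-- An infinite word with prefix `v` can be built letter by letter, following a strategy `s`. -/
theorem exists_pref_add_eq_iterate {A : Type*} (s : List A → A) (v : List A) :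
    ∃ w : ℕ → A, ∀ n, pref w (v.length + n) = (fun u => u ++ [s u])^[n] v := by
  refine ⟨fun i => if h : i < v.length then v[i]
    else s ((fun u => u ++ [s u])^[i - v.length] v), fun n => ?_⟩
  induction n with
  | zero =>
    refine List.ext_getElem (by simp [pref]) fun i _ h => ?_
    have hi : i < v.length := by simpa using h
    simp [pref, hi]
  | succ n ih =>
    rw [← add_assoc, pref_succ, ih, Function.iterate_succ_apply']
    simp

namespace AveragePreserving

variable {A : Type*} [Fintype A] {F G : List A → ℝ}

theorem sub (hF : AveragePreserving F) (hG : AveragePreserving G) :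
    AveragePreserving (fun v => F v - G v) := fun v => by
  rw [Finset.sum_sub_distrib, hF v, hG v, mul_sub]

theorem exists_le_append_singleton [Nonempty A] (hF : AveragePreserving F) (v : List A) :
    ∃ a, F v ≤ F (v ++ [a]) := by
  obtain ⟨a, -, ha⟩ := Finset.exists_le_of_sum_le (s := Finset.univ) (f := fun _ : A => F v)
    (g := fun a => F (v ++ [a])) Finset.univ_nonempty (by simp [hF v])
  exact ⟨a, ha⟩

theorem le_of_tendsto [Nonempty A] (hF : AveragePreserving F) {c : ℝ}
    (h : ∀ w : ℕ → A, Tendsto (fun k => F (pref w k)) atTop (𝓝 c)) (v : List A) : F v ≤ c := by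
  choose s hs using hF.exists_le_append_singleton
  obtain ⟨w, hw⟩ := exists_pref_add_eq_iterate s v
  have hle (n : ℕ) : F v ≤ F (pref w (v.length + n)) := by
    rw [hw]
    induction n with
    | zero => rfl
    | succ n ih =>
      rw [Function.iterate_succ_apply']
      exact ih.trans (hs _)
  refine ge_of_tendsto (h w) (eventually_atTop.2 ⟨v.length, fun k hk => ?_⟩)
  simpa [Nat.add_sub_cancel' hk] using hle (k - v.length)

theorem le_of_tendsto_same [Nonempty A] (hF : AveragePreserving F) (hG : AveragePreserving G)
    {f : (ℕ → A) → ℝ} (hFf : ∀ w : ℕ → A, Tendsto (fun k => F (pref w k)) atTop (𝓝 (f w)))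
    (hGf : ∀ w : ℕ → A, Tendsto (fun k => G (pref w k)) atTop (𝓝 (f w))) : F ≤ G := fun v =>
  sub_nonpos.1 <| (hF.sub hG).le_of_tendsto
    (fun w => by simpa using (hFf w).sub (hGf w)) v

end AveragePreserving

/-- Two average preserving word functions defining the same everywhere-defined
ω-function are equal. -/
theorem ap_same_omega_implies_equal
    {A : Type*} [Fintype A] [Nonempty A]
    (F G : List A → ℝ) (hF : AveragePreserving F) (hG : AveragePreserving G)
    (f : (ℕ → A) → ℝ)
    (hFf : ∀ w : ℕ → A, Tendsto (fun k => F (pref w k)) atTop (𝓝 (f w)))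
    (hGf : ∀ w : ℕ → A, Tendsto (fun k => G (pref w k)) atTop (𝓝 (f w))) :
    F = G :=
  le_antisymm (hF.le_of_tendsto_same hG hFf hGf) (hG.le_of_tendsto_same hF hGf hFf)
end

section
/- Let 𝒜 = (I, (A_a)_{a∈Σ}, F) be a WFA, let w ∈ Σ^ω, and let Δ = Σ*w = {uw : u ∈ Σ*}. Suppose that f_𝒜(v) is defined for every v ∈ Δ and that there exists a continuous function g : Σ^ω → ℝ with g(v) = f_𝒜(v) for all v ∈ Δ. Then there exists an average preserving WFA ℬ such that f_ℬ(v) is defined and equal to g(v) for every v ∈ Σ^ω. Moreover, if 𝒜 is left minimal then ℬ can be obtained from 𝒜 by changing only the final distribution F. -/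
open Filter Topology Matrix

/-- Concatenation of a finite word `u` with an infinite word `w`. -/
def wcat {A : Type*} (u : List A) (w : ℕ → A) : ℕ → A :=
  fun i => if h : i < u.length then u[i] else w (i - u.length)

/-- The product `A_{v₁} ⋯ A_{v_k}` of matrices along a finite word `v`. -/
def wordProd {A : Type*} {n : ℕ} (M : A → Matrix (Fin n) (Fin n) ℝ) (v : List A) :
    Matrix (Fin n) (Fin n) ℝ := (v.map M).prod

/-- The word function of the WFA `(I, M, F)`: `v ↦ I A_v F`. -/
def wfaWord {A : Type*} {n : ℕ} (I : Fin n → ℝ) (M : A → Matrix (Fin n) (Fin n) ℝ)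
    (F : Fin n → ℝ) (v : List A) : ℝ := I ⬝ᵥ (wordProd M v) *ᵥ F

/-- The WFA `(I, M, F)` is average preserving: `(∑_a A_a) F = |Σ| ⬝ F`. -/
def ApWFA {A : Type*} [Fintype A] {n : ℕ} (M : A → Matrix (Fin n) (Fin n) ℝ)
    (F : Fin n → ℝ) : Prop :=
  (∑ a : A, M a) *ᵥ F = (Fintype.card A : ℝ) • F

/-- The WFA `(I, M, F)` with `n` states is left minimal: the vectors `I A_u` span `ℝⁿ`. -/
def LeftMinimal {A : Type*} {n : ℕ} (I : Fin n → ℝ)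
    (M : A → Matrix (Fin n) (Fin n) ℝ) : Prop :=
  Submodule.span ℝ {x : Fin n → ℝ | ∃ u : List A, x = I ᵥ* (wordProd M u)} = ⊤

theorem pref_wcat {A : Type*} (u : List A) (w : ℕ → A) (k : ℕ) :
    pref (wcat u w) (u.length + k) = u ++ pref w k := by
  apply List.ext_getElem
  · simp [pref]
  · intro i h₁ h₂
    by_cases h : i < u.length
    · simp [pref, wcat, h]
    · simp [pref, wcat, h, List.getElem_append_right (not_lt.mp h)]

theorem wcat_append {A : Type*} (u v : List A) (w : ℕ → A) :
    wcat (u ++ v) w = wcat u (wcat v w) := by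
  funext i
  by_cases h : i < u.length
  · simp [wcat, h, Nat.lt_add_right]
  · by_cases h' : i - u.length < v.length
    · have : i < u.length + v.length := by omega
      simp [wcat, h, h', this, List.getElem_append_right (not_lt.mp h)]
    · have : ¬ i < u.length + v.length := by omega
      simp [wcat, h, h', this, Nat.sub_sub]

theorem wcat_of_lt {A : Type*} {u : List A} {i : ℕ} (h : i < u.length) (s t : ℕ → A) :
    wcat u s i = wcat u t i := by
  simp [wcat, h]

theorem wcat_pref_of_lt {A : Type*} (v t : ℕ → A) {i k : ℕ} (h : i < k) :
    wcat (pref v k) t i = v i := by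
  simp [wcat, pref, h]

/-- A continuous function on infinite words is uniformly continuous: its values on words
with a long common prefix are uniformly close. -/
theorem exists_prefix_length_abs_sub_le {A : Type*} [Finite A] [TopologicalSpace A]
    [DiscreteTopology A] {g : (ℕ → A) → ℝ} (hg : Continuous g) {ε : ℝ} (hε : 0 < ε) :
    ∃ N : ℕ, ∀ s t : ℕ → A, (∀ i < N, s i = t i) → |g s - g t| ≤ ε := by
  let _ : MetricSpace (ℕ → A) := PiNat.metricSpace
  have huc : UniformContinuous g := CompactSpace.uniformContinuous_of_continuous hg
  obtain ⟨δ, hδ, H⟩ := Metric.uniformContinuous_iff.mp huc ε hε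
  obtain ⟨N, hN⟩ := exists_pow_lt_of_lt_one hδ (by norm_num : (1 / 2 : ℝ) < 1)
  refine ⟨N, fun s t hst => (H ?_).le⟩
  exact ((PiNat.mem_cylinder_iff_dist_le (E := fun _ => A)).mp hst).trans_lt hN

theorem abs_inv_card_mul_sum_sub_le {A : Type*} [Fintype A] [Nonempty A] {f h : A → ℝ} {ε : ℝ}
    (H : ∀ a, |f a - h a| ≤ ε) :
    |(Fintype.card A : ℝ)⁻¹ * ∑ a, f a - (Fintype.card A : ℝ)⁻¹ * ∑ a, h a| ≤ ε := by
  have hc : (0 : ℝ) < Fintype.card A := by exact_mod_cast Fintype.card_pos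
  rw [← mul_sub, ← Finset.sum_sub_distrib, abs_mul, abs_of_pos (inv_pos.mpr hc),
    inv_mul_le_iff₀ hc]
  calc |∑ a, (f a - h a)| ≤ ∑ a, |f a - h a| := Finset.abs_sum_le_sum_abs _ _
    _ ≤ ∑ _a : A, ε := Finset.sum_le_sum fun a _ => H a
    _ = Fintype.card A * ε := by simp

section IteratedAverage

variable {A : Type*} [Fintype A] [Nonempty A] {g : (ℕ → A) → ℝ} {w : ℕ → A}
  {h : ℕ → List A → ℝ}

/-- Here and below, `h j u` is the average of `g (u x w)` over the words `x` of length `j`. -/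
theorem abs_iteratedAverage_sub_le (h0 : ∀ u, h 0 u = g (wcat u w))
    (hs : ∀ j u, h (j + 1) u = (Fintype.card A : ℝ)⁻¹ * ∑ a, h j (u ++ [a]))
    {c ε : ℝ} (j : ℕ) (u : List A) (hu : ∀ t, |g (wcat u t) - c| ≤ ε) : |h j u - c| ≤ ε := by
  induction j generalizing u with
  | zero => rw [h0]; exact hu w
  | succ j ih =>
    have hc : (Fintype.card A : ℝ) ≠ 0 := by exact_mod_cast Fintype.card_ne_zero
    have key := abs_inv_card_mul_sum_sub_le (f := fun a => h j (u ++ [a])) (h := fun _ => c)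
      (ε := ε) fun a => ih _ fun t => by rw [wcat_append]; exact hu _
    rw [hs]
    simpa [inv_mul_cancel_left₀ hc] using key

theorem abs_iteratedAverage_add_sub_le (h0 : ∀ u, h 0 u = g (wcat u w))
    (hs : ∀ j u, h (j + 1) u = (Fintype.card A : ℝ)⁻¹ * ∑ a, h j (u ++ [a]))
    {ε : ℝ} {N : ℕ} (hN : ∀ s t : ℕ → A, (∀ i < N, s i = t i) → |g s - g t| ≤ ε)
    (i j : ℕ) (u : List A) (hu : N ≤ u.length + j) : |h (j + i) u - h j u| ≤ ε := by
  induction j generalizing u with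
  | zero =>
    rw [h0 u]
    exact abs_iteratedAverage_sub_le h0 hs _ _ fun t =>
      hN _ _ fun l hl => wcat_of_lt (hl.trans_le hu) _ _
  | succ j ih =>
    rw [Nat.add_right_comm, hs, hs]
    exact abs_inv_card_mul_sum_sub_le fun a => ih _ (by simp; omega)

theorem exists_tendsto_iteratedAverage [TopologicalSpace A] [DiscreteTopology A]
    (hg : Continuous g) (h0 : ∀ u, h 0 u = g (wcat u w))
    (hs : ∀ j u, h (j + 1) u = (Fintype.card A : ℝ)⁻¹ * ∑ a, h j (u ++ [a])) (u : List A) :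
    ∃ l, Tendsto (fun j => h j u) atTop (𝓝 l) := by
  refine cauchySeq_tendsto_of_complete (Metric.cauchySeq_iff'.mpr fun ε hε => ?_)
  obtain ⟨N, hN⟩ := exists_prefix_length_abs_sub_le hg (half_pos hε)
  refine ⟨N, fun n hn => ?_⟩
  obtain ⟨i, rfl⟩ := Nat.exists_eq_add_of_le hn
  rw [Real.dist_eq]
  exact (abs_iteratedAverage_add_sub_le h0 hs hN i N u (by omega)).trans_lt (half_lt_self hε)

end IteratedAverage

theorem exists_tendsto_mulVec_of_span {n : ℕ} {S : Set (Fin n → ℝ)} {P : Matrix (Fin n) (Fin n) ℝ}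
    (hP : ∀ x, x ᵥ* P ∈ Submodule.span ℝ S) {z : ℕ → Fin n → ℝ}
    (hz : ∀ x ∈ S, ∃ l, Tendsto (fun k => x ⬝ᵥ z k) atTop (𝓝 l)) :
    ∃ L, Tendsto (fun k => P *ᵥ z k) atTop (𝓝 L) := by
  have hspan : ∀ x ∈ Submodule.span ℝ S, ∃ l, Tendsto (fun k => x ⬝ᵥ z k) atTop (𝓝 l) := by
    intro x hx
    induction hx using Submodule.span_induction with
    | mem x hx => exact hz x hx
    | zero => exact ⟨0, by simp⟩
    | add x y _ _ hx hy =>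
      obtain ⟨l, hl⟩ := hx
      obtain ⟨m, hm⟩ := hy
      exact ⟨l + m, by simpa only [add_dotProduct] using hl.add hm⟩
    | smul c x _ hx =>
      obtain ⟨l, hl⟩ := hx
      exact ⟨c • l, by simpa only [smul_dotProduct] using hl.const_smul c⟩
  choose L hL using fun i => hspan _ (hP (Pi.single i 1))
  refine ⟨L, tendsto_pi_nhds.mpr fun i => (hL i).congr fun k => ?_⟩
  rw [← dotProduct_mulVec, single_dotProduct, one_mul]

theorem tendsto_mulVec {n : ℕ} (Q : Matrix (Fin n) (Fin n) ℝ) {z : ℕ → Fin n → ℝ}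
    {L : Fin n → ℝ} (hz : Tendsto z atTop (𝓝 L)) :
    Tendsto (fun k => Q *ᵥ z k) atTop (𝓝 (Q *ᵥ L)) :=
  ((continuous_const.matrix_mulVec continuous_id).tendsto L).comp hz

theorem tendsto_dotProduct {n : ℕ} (x : Fin n → ℝ) {z : ℕ → Fin n → ℝ}
    {L : Fin n → ℝ} (hz : Tendsto z atTop (𝓝 L)) :
    Tendsto (fun k => x ⬝ᵥ z k) atTop (𝓝 (x ⬝ᵥ L)) :=
  ((continuous_const.dotProduct continuous_id).tendsto L).comp hz

theorem wordProd_append {A : Type*} {n : ℕ} (M : A → Matrix (Fin n) (Fin n) ℝ) (u v : List A) :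
    wordProd M (u ++ v) = wordProd M u * wordProd M v := by
  simp [wordProd]

theorem wordProd_singleton {A : Type*} {n : ℕ} (M : A → Matrix (Fin n) (Fin n) ℝ) (a : A) :
    wordProd M [a] = M a := by
  simp [wordProd]

/-- The span of the row vectors `I A_u`. -/
def leftSpan {A : Type*} {n : ℕ} (I : Fin n → ℝ) (M : A → Matrix (Fin n) (Fin n) ℝ) :
    Submodule ℝ (Fin n → ℝ) :=
  Submodule.span ℝ {x : Fin n → ℝ | ∃ u : List A, x = I ᵥ* (wordProd M u)}

theorem vecMul_wordProd_mem_leftSpan {A : Type*} {n : ℕ} (I : Fin n → ℝ)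
    (M : A → Matrix (Fin n) (Fin n) ℝ) (u : List A) : I ᵥ* wordProd M u ∈ leftSpan I M :=
  Submodule.subset_span ⟨u, rfl⟩

theorem vecMul_mem_leftSpan {A : Type*} {n : ℕ} {I : Fin n → ℝ}
    {M : A → Matrix (Fin n) (Fin n) ℝ} {x : Fin n → ℝ} (hx : x ∈ leftSpan I M) (a : A) :
    x ᵥ* M a ∈ leftSpan I M := by
  induction hx using Submodule.span_induction with
  | mem x hx =>
    obtain ⟨u, rfl⟩ := hx
    rw [vecMul_vecMul, ← wordProd_singleton M a, ← wordProd_append]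
    exact vecMul_wordProd_mem_leftSpan I M _
  | zero => simp
  | add x y _ _ hx hy => rw [add_vecMul]; exact add_mem hx hy
  | smul c x _ hx => rw [smul_vecMul]; exact Submodule.smul_mem _ c hx

theorem vecMul_wordProd_mul_left {A : Type*} {n : ℕ} {I : Fin n → ℝ}
    {M : A → Matrix (Fin n) (Fin n) ℝ} {P : Matrix (Fin n) (Fin n) ℝ}
    (hfix : ∀ x ∈ leftSpan I M, x ᵥ* P = x) (u : List A) {x : Fin n → ℝ}
    (hx : x ∈ leftSpan I M) :
    x ᵥ* wordProd (fun a => P * M a) u = x ᵥ* wordProd M u := by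
  induction u generalizing x with
  | nil => simp [wordProd]
  | cons a u ih =>
    have := ih (vecMul_mem_leftSpan hx a)
    simp only [wordProd, List.map_cons, List.prod_cons] at this ⊢
    rw [← vecMul_vecMul, ← vecMul_vecMul, hfix x hx, this, vecMul_vecMul]

/-- If `P` is a projection of the row space onto the span of the vectors `I A_u`, the matrices
`P A_a` carry an average preserving automaton for `g`. -/
theorem exists_apWFA_of_projection
    {A : Type*} [Fintype A] [Nonempty A] [TopologicalSpace A] [DiscreteTopology A]
    {n : ℕ} (I : Fin n → ℝ) (M : A → Matrix (Fin n) (Fin n) ℝ) (F : Fin n → ℝ)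
    (w : ℕ → A) (g : (ℕ → A) → ℝ) (hg : Continuous g)
    (hΔ : ∀ u : List A,
      Tendsto (fun k => wfaWord I M F (pref (wcat u w) k)) atTop (𝓝 (g (wcat u w))))
    {P : Matrix (Fin n) (Fin n) ℝ} (hP : ∀ x, x ᵥ* P ∈ leftSpan I M)
    (hfix : ∀ x ∈ leftSpan I M, x ᵥ* P = x) :
    ∃ F' : Fin n → ℝ, ApWFA (fun a => P * M a) F' ∧
      ∀ v : ℕ → A,
        Tendsto (fun k => wfaWord I (fun a => P * M a) F' (pref v k)) atTop (𝓝 (g v)) := by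
  have hdot : ∀ x ∈ leftSpan I M, ∀ z, x ⬝ᵥ P *ᵥ z = x ⬝ᵥ z := fun x hx z => by
    rw [dotProduct_mulVec, hfix x hx]
  have hz : ∀ u, Tendsto (fun k => I ᵥ* wordProd M u ⬝ᵥ wordProd M (pref w k) *ᵥ F) atTop
      (𝓝 (g (wcat u w))) := fun u => by
    refine ((hΔ u).comp (tendsto_add_atTop_nat u.length)).congr fun k => ?_
    rw [Function.comp_apply, add_comm, pref_wcat, wfaWord, wordProd_append, ← mulVec_mulVec,
      dotProduct_mulVec]
  obtain ⟨G, hG⟩ := exists_tendsto_mulVec_of_span hP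
    (z := fun k => wordProd M (pref w k) *ᵥ F) (by rintro _ ⟨u, rfl⟩; exact ⟨_, hz u⟩)
  have hGu : ∀ u, I ᵥ* wordProd M u ⬝ᵥ G = g (wcat u w) := fun u =>
    tendsto_nhds_unique (tendsto_dotProduct _ hG)
      ((hz u).congr fun k => (hdot _ (vecMul_wordProd_mem_leftSpan I M u) _).symm)
  set B : Matrix (Fin n) (Fin n) ℝ := (Fintype.card A : ℝ)⁻¹ • ∑ a, M a with hB
  set h : ℕ → List A → ℝ := fun j u => I ᵥ* wordProd M u ⬝ᵥ (B ^ j) *ᵥ G with hh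
  have h0 : ∀ u, h 0 u = g (wcat u w) := fun u => by simp [hh, hGu]
  have hs : ∀ j u, h (j + 1) u = (Fintype.card A : ℝ)⁻¹ * ∑ a, h j (u ++ [a]) := fun j u => by
    simp only [hh, wordProd_append, wordProd_singleton, pow_succ', ← mulVec_mulVec, hB,
      smul_mulVec, dotProduct_smul, sum_mulVec, dotProduct_sum, smul_eq_mul]
    simp only [← vecMul_vecMul, dotProduct_mulVec]
  obtain ⟨H, hH⟩ := exists_tendsto_mulVec_of_span hP (z := fun j => (B ^ j) *ᵥ G)
    (by rintro _ ⟨u, rfl⟩; exact exists_tendsto_iteratedAverage hg h0 hs u)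
  have hHu : ∀ u, Tendsto (fun j => h j u) atTop (𝓝 (I ᵥ* wordProd M u ⬝ᵥ H)) := fun u =>
    (tendsto_dotProduct _ hH).congr fun k => hdot _ (vecMul_wordProd_mem_leftSpan I M u) _
  have hBmem : ∀ x ∈ leftSpan I M, x ᵥ* B ∈ leftSpan I M := fun x hx => by
    rw [hB, vecMul_smul, vecMul_sum]
    exact Submodule.smul_mem _ _ (sum_mem fun a _ => vecMul_mem_leftSpan hx a)
  have hPBP : P * B * P = P * B := ext_of_single_vecMul fun i => by
    rw [← vecMul_vecMul, hfix]
    rw [← vecMul_vecMul]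
    exact hBmem _ (hP _)
  have hinv : (P * B) *ᵥ H = H := by
    refine tendsto_nhds_unique (tendsto_mulVec (P * B) hH)
      ((hH.comp (tendsto_add_atTop_nat 1)).congr fun j => ?_)
    simp only [Function.comp_apply]
    rw [mulVec_mulVec _ (P * B), hPBP, pow_succ', mulVec_mulVec, mulVec_mulVec, mul_assoc]
  refine ⟨H, ?_, fun v => ?_⟩
  · have hc : (Fintype.card A : ℝ) ≠ 0 := by exact_mod_cast Fintype.card_ne_zero
    have hsum : ∑ a, P * M a = (Fintype.card A : ℝ) • (P * B) := by
      rw [hB, Matrix.mul_smul, smul_inv_smul₀ hc, Finset.mul_sum]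
    rw [ApWFA, hsum, smul_mulVec, hinv]
  · have hword : ∀ u, wfaWord I (fun a => P * M a) H u = I ᵥ* wordProd M u ⬝ᵥ H := fun u => by
      rw [wfaWord, dotProduct_mulVec, vecMul_wordProd_mul_left hfix u]
      simpa [wordProd] using vecMul_wordProd_mem_leftSpan I M []
    refine Metric.tendsto_atTop.mpr fun ε hε => ?_
    obtain ⟨N, hN⟩ := exists_prefix_length_abs_sub_le hg (half_pos hε)
    refine ⟨N, fun k hk => ?_⟩
    rw [Real.dist_eq, hword]
    refine lt_of_le_of_lt ?_ (half_lt_self hε)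
    refine le_of_tendsto ((hHu (pref v k)).sub_const (g v)).abs (Eventually.of_forall fun j => ?_)
    exact abs_iteratedAverage_sub_le h0 hs _ _ fun t =>
      hN _ _ fun i hi => wcat_pref_of_lt v t (hi.trans_le hk)

theorem exists_matrix_projection {n : ℕ} (V : Submodule ℝ (Fin n → ℝ)) :
    ∃ P : Matrix (Fin n) (Fin n) ℝ, (∀ x, x ᵥ* P ∈ V) ∧ ∀ x ∈ V, x ᵥ* P = x := by
  obtain ⟨p, hp⟩ := V.subtype.exists_leftInverse_of_injective V.ker_subtype
  have hQ : ∀ x, x ᵥ* (LinearMap.toMatrix' (V.subtype ∘ₗ p))ᵀ = p x := fun x => by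
    rw [vecMul_transpose, ← Matrix.toLin'_apply, Matrix.toLin'_toMatrix']
    rfl
  refine ⟨(LinearMap.toMatrix' (V.subtype ∘ₗ p))ᵀ, fun x => ?_, fun x hx => ?_⟩
  · rw [hQ]; exact (p x).2
  · rw [hQ]; exact congrArg Subtype.val (LinearMap.congr_fun hp ⟨x, hx⟩)

/-- Let `𝒜 = (I, (A_a), F)` be a WFA and `w ∈ Σ^ω`, and let `Δ = Σ*w`.  Suppose that `f_𝒜`
is defined on `Δ` and agrees there with a continuous function `g : Σ^ω → ℝ`.  Then there is
an average preserving WFA `ℬ` with `f_ℬ = g` everywhere; moreover, if `𝒜` is left minimal,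
then `ℬ` can be obtained from `𝒜` by changing only the final distribution. -/
theorem redistribution
    {A : Type*} [Fintype A] [Nonempty A] [TopologicalSpace A] [DiscreteTopology A]
    {n : ℕ} (I : Fin n → ℝ) (M : A → Matrix (Fin n) (Fin n) ℝ) (F : Fin n → ℝ)
    (w : ℕ → A) (g : (ℕ → A) → ℝ) (hg : Continuous g)
    (hΔ : ∀ u : List A,
      Tendsto (fun k => wfaWord I M F (pref (wcat u w) k)) atTop (𝓝 (g (wcat u w)))) :
    (∃ (m : ℕ) (I' : Fin m → ℝ) (M' : A → Matrix (Fin m) (Fin m) ℝ) (F' : Fin m → ℝ),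
        ApWFA M' F' ∧
        ∀ v : ℕ → A, Tendsto (fun k => wfaWord I' M' F' (pref v k)) atTop (𝓝 (g v))) ∧
    (LeftMinimal I M → ∃ F' : Fin n → ℝ,
        ApWFA M F' ∧
        ∀ v : ℕ → A, Tendsto (fun k => wfaWord I M F' (pref v k)) atTop (𝓝 (g v))) := by
  refine ⟨?_, fun hmin => ?_⟩
  · obtain ⟨P, hP, hfix⟩ := exists_matrix_projection (leftSpan I M)
    obtain ⟨F', hap, hlim⟩ := exists_apWFA_of_projection I M F w g hg hΔ hP hfix
    exact ⟨n, I, fun a => P * M a, F', hap, hlim⟩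
  · have htop : leftSpan I M = ⊤ := hmin
    simpa using exists_apWFA_of_projection I M F w g hg hΔ (P := 1) (by simp [htop]) (by simp)
end

section
/- Let F : Σ* → ℝ be an average preserving word function whose ω-function f(w) = lim_{k→∞} F(pref_k(w)) exists for every w ∈ Σ^ω and is continuous on Σ^ω. Then F is uniformly convergent. -/
open Filter Topology

/-- `F` is uniformly convergent with ω-function `f`. -/
def UnifConv {A : Type*} (F : List A → ℝ) (f : (ℕ → A) → ℝ) : Prop :=
  (∀ w : ℕ → A, Tendsto (fun k => F (pref w k)) atTop (𝓝 (f w))) ∧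
  ∀ ε > (0 : ℝ), ∃ k₀ : ℕ, ∀ w : ℕ → A, ∀ k > k₀, |F (pref w k) - f w| < ε

theorem pref_congr {A : Type*} {u w : ℕ → A} {k : ℕ} (h : ∀ i < k, u i = w i) :
    pref u k = pref w k :=
  List.map_congr_left fun i hi => h i (List.mem_range.mp hi)

theorem AveragePreserving.neg {A : Type*} [Fintype A] {F : List A → ℝ}
    (hap : AveragePreserving F) : AveragePreserving (fun v => -F v) := fun v => by
  rw [Finset.sum_neg_distrib, hap v, mul_neg]

theorem AveragePreserving.exists_le_append {A : Type*} [Fintype A] [Nonempty A] {F : List A → ℝ}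
    (hap : AveragePreserving F) (v : List A) : ∃ a : A, F v ≤ F (v ++ [a]) := by
  obtain ⟨a, -, ha⟩ := Finset.exists_le_of_sum_le (s := (Finset.univ : Finset A))
    (f := fun _ => F v) (g := fun a => F (v ++ [a])) Finset.univ_nonempty (by simp [hap v])
  exact ⟨a, ha⟩

/-- Every finite prefix extends to an infinite word whose limit value is at least the value of
the prefix. -/
theorem AveragePreserving.exists_extension_ge {A : Type*} [Fintype A] [Nonempty A]
    {F : List A → ℝ} {f : (ℕ → A) → ℝ} (hap : AveragePreserving F)
    (hf : ∀ w : ℕ → A, Tendsto (fun k => F (pref w k)) atTop (𝓝 (f w))) (u : ℕ → A) (n : ℕ) :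
    ∃ w : ℕ → A, (∀ i < n, w i = u i) ∧ F (pref u n) ≤ f w := by
  choose g hg using hap.exists_le_append
  let L : ℕ → List A := fun k => (fun v => v ++ [g v])^[k] (pref u n)
  have hL (k : ℕ) : L (k + 1) = L k ++ [g (L k)] := Function.iterate_succ_apply' _ _ _
  let w : ℕ → A := fun i => if i < n then u i else g (L (i - n))
  have hwu : ∀ i < n, w i = u i := fun i hi => if_pos hi
  have hw (k : ℕ) : pref w (n + k) = L k := by
    induction k with
    | zero => exact pref_congr hwu
    | succ k ih => rw [← add_assoc, pref_succ, ih, hL]; simp [w]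
  have hmono : Monotone fun k => F (L k) := monotone_nat_of_le_succ fun k => by
    rw [hL]
    exact hg (L k)
  refine ⟨w, hwu, ge_of_tendsto (hf w) ?_⟩
  filter_upwards [eventually_ge_atTop n] with k hk
  obtain ⟨j, rfl⟩ := Nat.exists_eq_add_of_le hk
  rw [hw]
  exact hmono j.zero_le

/-- A continuous real function on infinite words over a finite alphabet varies by less than `ε`
among words sharing a sufficiently long prefix. -/
theorem exists_prefix_modulus {A : Type*} [Finite A] [TopologicalSpace A] [DiscreteTopology A]
    {f : (ℕ → A) → ℝ} (hcont : Continuous f) {ε : ℝ} (hε : 0 < ε) :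
    ∃ n : ℕ, ∀ u w : ℕ → A, (∀ i < n, u i = w i) → |f u - f w| < ε := by
  let _ : MetricSpace (ℕ → A) := PiNat.metricSpace
  obtain ⟨δ, hδ, h⟩ := Metric.uniformContinuous_iff.mp
    (CompactSpace.uniformContinuous_of_continuous hcont) ε hε
  obtain ⟨n, hn⟩ := exists_pow_lt_of_lt_one hδ (one_half_lt_one (α := ℝ))
  exact ⟨n, fun u w huw => h (lt_of_le_of_lt (PiNat.mem_cylinder_iff_dist_le.mp huw) hn)⟩

/-- An average preserving word function whose ω-function is everywhere defined and
continuous on `Σ^ω` is uniformly convergent. -/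
theorem ap_continuous_implies_unifConv
    {A : Type*} [Fintype A] [Nonempty A] [TopologicalSpace A] [DiscreteTopology A]
    (F : List A → ℝ) (f : (ℕ → A) → ℝ)
    (hap : AveragePreserving F)
    (hf : ∀ w : ℕ → A, Tendsto (fun k => F (pref w k)) atTop (𝓝 (f w)))
    (hcont : Continuous f) :
    UnifConv F f := by
  refine ⟨hf, fun ε hε => ?_⟩
  obtain ⟨n, hn⟩ := exists_prefix_modulus hcont hε
  refine ⟨n, fun w k hk => ?_⟩
  obtain ⟨u, hu, hFu⟩ := hap.exists_extension_ge hf w k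
  obtain ⟨v, hv, hFv⟩ := hap.neg.exists_extension_ge (f := fun w => -f w) (fun w => (hf w).neg) w k
  have h₁ := abs_lt.mp (hn u w fun i hi => hu i (hi.trans hk))
  have h₂ := abs_lt.mp (hn v w fun i hi => hv i (hi.trans hk))
  exact abs_lt.mpr ⟨by linarith, by linarith⟩
end

section
/- Let F : Σ* → ℝ be a uniformly convergent word function with ω-function f. Then for every w ∈ Σ^ω and every u ∈ Σ*, lim_{k→∞} F(pref_k(w)u) = f(w), where pref_k(w)u denotes the concatenation of the length-k prefix of w with u. -/
open Filter Topology

@[simp]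
theorem length_pref {A : Type*} (w : ℕ → A) (k : ℕ) : (pref w k).length = k := by
  simp [pref]

theorem take_pref {A : Type*} (w : ℕ → A) {m k : ℕ} (h : m ≤ k) :
    (pref w k).take m = pref w m := by
  simp [pref, ← List.map_take, List.take_range, h]

/-- The prefixes of a finite word padded to an infinite one are prefixes of the finite word. -/
theorem pref_getD {A : Type*} (l : List A) (a : A) {m : ℕ} (h : m ≤ l.length) :
    pref (fun i => l.getD i a) m = l.take m := by
  apply List.ext_getElem
  · simp [h]
  · intro i hi _
    have hi' : i < l.length := lt_of_lt_of_le (by simpa using hi) h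
    simp [pref, hi']

/-- If `F` is a uniformly convergent word function with ω-function `f`, then for every
`w ∈ Σ^ω` and `u ∈ Σ*`, `lim_k F(pref_k(w)u) = f(w)`. -/
theorem unifConv_suffix_limit
    {A : Type*} [Fintype A] [Nonempty A]
    (F : List A → ℝ) (f : (ℕ → A) → ℝ) (h : UnifConv F f)
    (w : ℕ → A) (u : List A) :
    Tendsto (fun k => F (pref w k ++ u)) atTop (𝓝 (f w)) := by
  obtain ⟨a⟩ := ‹Nonempty A›
  rw [Metric.tendsto_atTop]
  intro ε hε
  obtain ⟨k₀, hk₀⟩ := h.2 (ε / 3) (by positivity)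
  refine ⟨k₀ + 1, fun k hk => ?_⟩
  let v : ℕ → A := fun i => (pref w k ++ u).getD i a
  have hv : pref v (k + u.length) = pref w k ++ u := by
    rw [pref_getD _ _ (by simp)]
    exact List.take_of_length_le (by simp)
  have hvw : pref v (k₀ + 1) = pref w (k₀ + 1) := by
    rw [pref_getD _ _ (by simp; omega), List.take_append_of_le_length (by simpa using hk),
      take_pref w hk]
  have h₁ := hk₀ v (k + u.length) (by omega)
  have h₂ := hk₀ v (k₀ + 1) (by omega)
  have h₃ := hk₀ w (k₀ + 1) (by omega)
  rw [hv] at h₁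
  rw [hvw] at h₂
  rw [Real.dist_eq]
  rw [abs_lt] at *
  constructor <;> linarith
end

section
/- Let 𝒜 = (I, (A_a)_{a∈Σ}, F) be a left minimal WFA and let ℬ = (I', (A_a)_{a∈Σ}, F) be obtained from 𝒜 by replacing the initial distribution I with an arbitrary row vector I'. Then: (1) if f_𝒜(w) is defined for every w ∈ Σ^ω, then f_ℬ(w) is defined for every w ∈ Σ^ω; (2) if f_𝒜 is defined everywhere and continuous on Σ^ω, then so is f_ℬ; (3) if 𝒜 is uniformly convergent, then so is ℬ. -/
open Filter Topology Matrix

/-- The WFA with `n` states is right minimal: the column vectors `A_u F` span `ℝⁿ`. -/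
def RightMinimal {A : Type*} {n : ℕ} (M : A → Matrix (Fin n) (Fin n) ℝ)
    (F : Fin n → ℝ) : Prop :=
  Submodule.span ℝ {x : Fin n → ℝ | ∃ u : List A, x = (wordProd M u) *ᵥ F} = ⊤

section ChangeInitialDistribution

variable {A : Type*} {n : ℕ}

/-- The infinite word `a w` obtained by putting the letter `a` in front of `w`. -/
def consWord (a : A) (w : ℕ → A) : ℕ → A
  | 0 => a
  | k + 1 => w k

lemma pref_consWord (a : A) (w : ℕ → A) (k : ℕ) :
    pref (consWord a w) (k + 1) = a :: pref w k := by
  simp [pref, List.range_succ_eq_map, consWord, Function.comp_def]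

lemma continuous_consWord [TopologicalSpace A] (a : A) :
    Continuous (consWord a : (ℕ → A) → ℕ → A) := by
  refine continuous_pi fun k => ?_
  cases k with
  | zero => exact continuous_const
  | succ k => exact continuous_apply k

variable (M : A → Matrix (Fin n) (Fin n) ℝ) (F : Fin n → ℝ)

lemma wfaWord_zero (v : List A) : wfaWord 0 M F v = 0 := by
  simp [wfaWord]

lemma wfaWord_add (J K : Fin n → ℝ) (v : List A) :
    wfaWord (J + K) M F v = wfaWord J M F v + wfaWord K M F v := by
  simp [wfaWord, add_dotProduct]

lemma wfaWord_smul (c : ℝ) (J : Fin n → ℝ) (v : List A) :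
    wfaWord (c • J) M F v = c * wfaWord J M F v := by
  simp [wfaWord, smul_dotProduct]

lemma wfaWord_vecMul_pref (J : Fin n → ℝ) (a : A) (w : ℕ → A) (k : ℕ) :
    wfaWord (J ᵥ* M a) M F (pref w k) = wfaWord J M F (pref (consWord a w) (k + 1)) := by
  simp [wfaWord, wordProd, pref_consWord, ← mulVec_mulVec, dotProduct_mulVec]

variable {M}

/-- For a left minimal automaton with initial distribution `I`, every family of row vectors that
contains `I` and is a linear subspace stable under the transition matrices is everything. -/
lemma LeftMinimal.induction {I : Fin n → ℝ} (hmin : LeftMinimal I M)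
    {P : (Fin n → ℝ) → Prop} (zero : P 0) (add : ∀ J K, P J → P K → P (J + K))
    (smul : ∀ (c : ℝ) J, P J → P (c • J)) (step : ∀ J a, P J → P (J ᵥ* M a))
    (init : P I) (J : Fin n → ℝ) : P J := by
  have reach : ∀ (u : List A) (K : Fin n → ℝ), P K → P (K ᵥ* wordProd M u) := by
    intro u
    induction u with
    | nil => intro K hK; simpa [wordProd] using hK
    | cons a u ih =>
      intro K hK
      simpa [wordProd, vecMul_vecMul] using ih _ (step K a hK)
  have hJ : J ∈ Submodule.span ℝ {x : Fin n → ℝ | ∃ u : List A, x = I ᵥ* wordProd M u} := by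
    rw [show Submodule.span ℝ _ = ⊤ from hmin]
    trivial
  induction hJ using Submodule.span_induction with
  | mem x hx => obtain ⟨u, rfl⟩ := hx; exact reach u I init
  | zero => exact zero
  | add x y _ _ hx hy => exact add x y hx hy
  | smul c x _ hx => exact smul c x hx

lemma unifConv_iff_tendstoUniformly (G : List A → ℝ) (f : (ℕ → A) → ℝ) :
    UnifConv G f ↔ TendstoUniformly (fun k w => G (pref w k)) f atTop := by
  constructor
  · rintro ⟨-, h⟩
    refine Metric.tendstoUniformly_iff.2 fun ε hε => ?_
    obtain ⟨k₀, hk₀⟩ := h ε hε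
    filter_upwards [eventually_gt_atTop k₀] with k hk w
    rw [dist_comm, Real.dist_eq]
    exact hk₀ w k hk
  · intro h
    refine ⟨fun w => h.tendsto_at w, fun ε hε => ?_⟩
    obtain ⟨k₀, hk₀⟩ := eventually_atTop.1 (Metric.tendstoUniformly_iff.1 h ε hε)
    refine ⟨k₀, fun w k hk => ?_⟩
    rw [← Real.dist_eq, dist_comm]
    exact hk₀ k hk.le w

end ChangeInitialDistribution

/-- Let `𝒜 = (I, (A_a), F)` be a left minimal WFA and let `ℬ = (I', (A_a), F)` be obtained
from `𝒜` by replacing the initial distribution by an arbitrary row vector `I'`.  Then: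
(1) if `f_𝒜` is everywhere defined, so is `f_ℬ`;
(2) if `f_𝒜` is everywhere defined and continuous, so is `f_ℬ`;
(3) if `𝒜` is uniformly convergent, so is `ℬ`. -/
theorem change_initial_distribution
    {A : Type*} [Fintype A] [Nonempty A] [TopologicalSpace A] [DiscreteTopology A]
    {n : ℕ} (I I' : Fin n → ℝ) (M : A → Matrix (Fin n) (Fin n) ℝ) (F : Fin n → ℝ)
    (hmin : LeftMinimal I M) :
    ((∃ f : (ℕ → A) → ℝ,
        ∀ w : ℕ → A, Tendsto (fun k => wfaWord I M F (pref w k)) atTop (𝓝 (f w))) →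
      ∃ g : (ℕ → A) → ℝ,
        ∀ w : ℕ → A, Tendsto (fun k => wfaWord I' M F (pref w k)) atTop (𝓝 (g w))) ∧
    ((∃ f : (ℕ → A) → ℝ, Continuous f ∧
        ∀ w : ℕ → A, Tendsto (fun k => wfaWord I M F (pref w k)) atTop (𝓝 (f w))) →
      ∃ g : (ℕ → A) → ℝ, Continuous g ∧
        ∀ w : ℕ → A, Tendsto (fun k => wfaWord I' M F (pref w k)) atTop (𝓝 (g w))) ∧
    ((∃ f : (ℕ → A) → ℝ, UnifConv (wfaWord I M F) f) →
      ∃ g : (ℕ → A) → ℝ, UnifConv (wfaWord I' M F) g) := by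
  have tendsto_step : ∀ (J : Fin n → ℝ) (a : A) (f : (ℕ → A) → ℝ),
      (∀ w, Tendsto (fun k => wfaWord J M F (pref w k)) atTop (𝓝 (f w))) →
      ∀ w, Tendsto (fun k => wfaWord (J ᵥ* M a) M F (pref w k)) atTop
        (𝓝 (f (consWord a w))) := by
    intro J a f hf w
    simp only [wfaWord_vecMul_pref]
    exact (hf (consWord a w)).comp (tendsto_add_atTop_nat 1)
  refine ⟨fun h => ?_, fun h => ?_, fun h => ?_⟩
  · refine hmin.induction (P := fun J => ∃ g : (ℕ → A) → ℝ, ∀ w : ℕ → A,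
      Tendsto (fun k => wfaWord J M F (pref w k)) atTop (𝓝 (g w))) ?_ ?_ ?_ ?_ h I'
    · exact ⟨0, fun w => by simp [wfaWord_zero]⟩
    · rintro J K ⟨f, hf⟩ ⟨g, hg⟩
      exact ⟨f + g, fun w => by simpa only [wfaWord_add, Pi.add_apply] using (hf w).add (hg w)⟩
    · rintro c J ⟨f, hf⟩
      exact ⟨fun w => c * f w, fun w => by simpa only [wfaWord_smul] using (hf w).const_mul c⟩
    · rintro J a ⟨f, hf⟩
      exact ⟨fun w => f (consWord a w), tendsto_step J a f hf⟩
  · refine hmin.induction (P := fun J => ∃ g : (ℕ → A) → ℝ, Continuous g ∧ ∀ w : ℕ → A,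
      Tendsto (fun k => wfaWord J M F (pref w k)) atTop (𝓝 (g w))) ?_ ?_ ?_ ?_ h I'
    · exact ⟨0, continuous_zero, fun w => by simp [wfaWord_zero]⟩
    · rintro J K ⟨f, hfc, hf⟩ ⟨g, hgc, hg⟩
      exact ⟨f + g, hfc.add hgc,
        fun w => by simpa only [wfaWord_add, Pi.add_apply] using (hf w).add (hg w)⟩
    · rintro c J ⟨f, hfc, hf⟩
      exact ⟨fun w => c * f w, hfc.const_mul c,
        fun w => by simpa only [wfaWord_smul] using (hf w).const_mul c⟩
    · rintro J a ⟨f, hfc, hf⟩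
      exact ⟨fun w => f (consWord a w), hfc.comp (continuous_consWord a), tendsto_step J a f hf⟩
  · simp only [unifConv_iff_tendstoUniformly] at h ⊢
    refine hmin.induction (P := fun J => ∃ g : (ℕ → A) → ℝ,
      TendstoUniformly (fun k w => wfaWord J M F (pref w k)) g atTop) ?_ ?_ ?_ ?_ h I'
    · refine ⟨0, Metric.tendstoUniformly_iff.2 fun ε hε => ?_⟩
      simp [wfaWord_zero, hε]
    · rintro J K ⟨f, hf⟩ ⟨g, hg⟩
      refine ⟨f + g, ?_⟩
      simp only [wfaWord_add]
      exact hf.add hg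
    · rintro c J ⟨f, hf⟩
      refine ⟨fun w => c * f w, ?_⟩
      simp only [wfaWord_smul]
      exact (uniformContinuous_const_smul c).comp_tendstoUniformly hf
    · rintro J a ⟨f, hf⟩
      refine ⟨fun w => f (consWord a w), ?_⟩
      simp only [wfaWord_vecMul_pref]
      intro s hs
      filter_upwards [(tendsto_add_atTop_nat 1).eventually (hf s hs)] with k hk w
      exact hk (consWord a w)
end
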